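/- For every m ∈ ℕ there exists an even-sized cake 𝒞 with R(𝒞) = m and M(𝒞) = m; that is, there are arbitrarily large even-sized cakes on which, with optimal play, Bob obtains the entirety of the total weight. -/

import Mathlib

open scoped Classical

noncomputable section

/-- Determinant of the pair of vectors `(q - p, r - p)`. -/
def orientDet (p q r : ℝ × ℝ) : ℝ :=
  (q.1 - p.1) * (r.2 - p.2) - (q.2 - p.2) * (r.1 - p.1)

/-- The orientation `∇ p q r` : `+1` for counterclockwise, `-1` for clockwise, `0` collinear. -/
def orient (p q r : ℝ × ℝ) : ℝ := Real.sign (orientDet p q r)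

/-- A set of points is in general position if no three of its points are collinear. -/
def GenPos (C : Set (ℝ × ℝ)) : Prop :=
  ∀ p ∈ C, ∀ q ∈ C, ∀ r ∈ C, p ≠ q → p ≠ r → q ≠ r → orientDet p q r ≠ 0

/-- The extremal points of a finite set `C`. -/
def exPts (C : Finset (ℝ × ℝ)) : Finset (ℝ × ℝ) :=
  C.filter (fun c => c ∉ convexHull ℝ ((C.erase c : Finset (ℝ × ℝ)) : Set (ℝ × ℝ)))

/-- The minimax value (Bob's total, Alice to move) of the convex grabbing game. -/
def gameM (w : ℝ × ℝ → ℕ) (C : Finset (ℝ × ℝ)) : ℕ :=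
  if h : C.card ≤ 1 then 0
  else
    sInf (↑((exPts C).attach.image (fun a =>
      (exPts (C.erase a.1)).attach.sup (fun b =>
        w b.1 + gameM w ((C.erase a.1).erase b.1)))) : Set ℕ)
termination_by C.card
decreasing_by
  have ha : a.1 ∈ C := Finset.mem_of_mem_filter _ a.2
  have hb : b.1 ∈ C.erase a.1 := Finset.mem_of_mem_filter _ b.2
  calc ((C.erase a.1).erase b.1).card
      < (C.erase a.1).card := Finset.card_erase_lt_of_mem hb
    _ ≤ C.card := Finset.card_erase_le

/-- The minimax value of the game when it is Bob's turn to move. -/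
def gameMB (w : ℝ × ℝ → ℕ) (C : Finset (ℝ × ℝ)) : ℕ :=
  (exPts C).sup (fun b => w b + gameM w (C.erase b))


/-- The green point with index `i`, on the standard parabola. -/
def greenPt (i : ℕ) : ℝ × ℝ := ((i : ℝ), (i : ℝ) ^ 2)

/-- The red point with index `i`, slightly above the green one. -/
def redPt (i : ℕ) : ℝ × ℝ := ((i : ℝ), (i : ℝ) ^ 2 + 1 / 2)

/-- The indices of `S` that are neither its minimum nor its maximum. -/
def innerIdx (S : Finset ℕ) : Finset ℕ :=
  S.filter (fun j => (∃ i ∈ S, i < j) ∧ ∃ k ∈ S, j < k)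

/-- The green points indexed by `S`, with a red point above every inner one. -/
def parabolaCake (S : Finset ℕ) : Finset (ℝ × ℝ) :=
  S.image greenPt ∪ (innerIdx S).image redPt

/-- The weight function whose red points are exactly the points `redPt i`. -/
def redWeight (p : ℝ × ℝ) : ℕ := if ∃ i, p = redPt i then 1 else 0

theorem greenPt_injective : Function.Injective greenPt := fun i j h => by
  simpa [greenPt] using congrArg Prod.fst h

theorem redPt_injective : Function.Injective redPt := fun i j h => by
  simpa [redPt] using congrArg Prod.fst h

theorem greenPt_ne_redPt (i j : ℕ) : greenPt i ≠ redPt j := by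
  intro h
  have h1 : (i : ℝ) = j := congrArg Prod.fst h
  have h2 : (i : ℝ) ^ 2 = (j : ℝ) ^ 2 + 1 / 2 := congrArg Prod.snd h
  rw [h1] at h2
  linarith

theorem mem_innerIdx {S : Finset ℕ} {j : ℕ} :
    j ∈ innerIdx S ↔ j ∈ S ∧ (∃ i ∈ S, i < j) ∧ ∃ k ∈ S, j < k := by
  simp [innerIdx]

theorem mem_parabolaCake {S : Finset ℕ} {p : ℝ × ℝ} :
    p ∈ parabolaCake S ↔ (∃ i ∈ S, greenPt i = p) ∨ ∃ i ∈ innerIdx S, redPt i = p := by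
  simp [parabolaCake]

theorem exists_index_of_mem {S : Finset ℕ} {p : ℝ × ℝ} (hp : p ∈ parabolaCake S) :
    ∃ i ∈ S, p = greenPt i ∨ p = redPt i := by
  rcases mem_parabolaCake.1 hp with ⟨i, hi, rfl⟩ | ⟨i, hi, rfl⟩
  · exact ⟨i, hi, Or.inl rfl⟩
  · exact ⟨i, (mem_innerIdx.1 hi).1, Or.inr rfl⟩

theorem redWeight_redPt (i : ℕ) : redWeight (redPt i) = 1 := if_pos ⟨i, rfl⟩

theorem redWeight_greenPt (i : ℕ) : redWeight (greenPt i) = 0 :=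
  if_neg fun ⟨j, h⟩ => greenPt_ne_redPt i j h

theorem redWeight_le_one (p : ℝ × ℝ) : redWeight p ≤ 1 := by
  unfold redWeight
  split_ifs <;> simp

theorem card_parabolaCake (S : Finset ℕ) :
    (parabolaCake S).card = S.card + (innerIdx S).card := by
  rw [parabolaCake, Finset.card_union_of_disjoint, Finset.card_image_of_injective _
    greenPt_injective, Finset.card_image_of_injective _ redPt_injective]
  rw [Finset.disjoint_left]
  intro p hp hq
  obtain ⟨i, -, rfl⟩ := Finset.mem_image.1 hp
  obtain ⟨j, -, h⟩ := Finset.mem_image.1 hq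
  exact greenPt_ne_redPt i j h.symm

theorem filter_redWeight_parabolaCake (S : Finset ℕ) :
    (parabolaCake S).filter (fun p => redWeight p = 1) = (innerIdx S).image redPt := by
  ext p
  simp only [Finset.mem_filter, mem_parabolaCake, Finset.mem_image]
  constructor
  · rintro ⟨⟨i, -, rfl⟩ | h, hw⟩
    · simp [redWeight_greenPt] at hw
    · exact h
  · rintro ⟨i, hi, rfl⟩
    exact ⟨Or.inr ⟨i, hi, rfl⟩, redWeight_redPt i⟩

theorem card_innerIdx_range (m : ℕ) : (innerIdx (Finset.range (m + 2))).card = m := by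
  have h : innerIdx (Finset.range (m + 2)) = Finset.Ioo 0 (m + 1) := by
    ext j
    simp only [mem_innerIdx, Finset.mem_range, Finset.mem_Ioo]
    constructor
    · rintro ⟨-, ⟨i, -, hi⟩, k, hk, hj⟩
      omega
    · rintro ⟨h0, h1⟩
      exact ⟨by omega, ⟨0, by omega, h0⟩, m + 1, by omega, h1⟩
  simp [h]

/-- A point on which a linear functional attains a strict minimum is extremal. -/
theorem mem_exPts_of_forall_lt {C : Finset (ℝ × ℝ)} {c : ℝ × ℝ} (hc : c ∈ C) (a b : ℝ)
    (h : ∀ p ∈ C, p ≠ c → a * c.1 + b * c.2 < a * p.1 + b * p.2) : c ∈ exPts C := by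
  refine Finset.mem_filter.2 ⟨hc, fun hmem => ?_⟩
  have hconv : Convex ℝ {p : ℝ × ℝ | a * c.1 + b * c.2 < a * p.1 + b * p.2} := by
    refine convex_halfSpace_gt (f := fun p : ℝ × ℝ => a * p.1 + b * p.2) ⟨?_, ?_⟩ _
    · intro x y
      simp only [Prod.fst_add, Prod.snd_add]
      ring
    · intro t x
      simp only [Prod.smul_fst, Prod.smul_snd, smul_eq_mul]
      ring
  have hsub : ((C.erase c : Finset (ℝ × ℝ)) : Set (ℝ × ℝ)) ⊆
      {p : ℝ × ℝ | a * c.1 + b * c.2 < a * p.1 + b * p.2} := by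
    intro p hp
    have hp' := Finset.mem_erase.1 (Finset.mem_coe.1 hp)
    exact h p hp'.2 hp'.1
  exact (lt_irrefl (a * c.1 + b * c.2)) (convexHull_min hsub hconv hmem)

theorem redPt_mem_convexHull {i j k : ℕ} (hij : i < j) (hjk : j < k) :
    redPt j ∈ convexHull ℝ {greenPt i, greenPt j, greenPt k} := by
  have h1 : (i : ℝ) + 1 ≤ j := by exact_mod_cast hij
  have h2 : (j : ℝ) + 1 ≤ k := by exact_mod_cast hjk
  have hx : (0 : ℝ) < j - i := by linarith
  have hy : (0 : ℝ) < k - j := by linarith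
  have hz : (0 : ℝ) < k - i := by linarith
  set s : ℝ := 1 / (2 * (j - i) * (k - i)) with hs
  set t : ℝ := 1 / (2 * (k - j) * (k - i)) with ht
  have hs0 : 0 < s := by positivity
  have ht0 : 0 < t := by positivity
  have hst : s * (j - i) = t * (k - j) := by
    rw [hs, ht]; field_simp
  have hsum : s * (j - i) ^ 2 + t * (k - j) ^ 2 = 1 / 2 := by
    rw [hs, ht]; field_simp; ring
  have hle : s + t ≤ 1 / 2 := by
    have e1 : s ≤ s * (j - i) ^ 2 := le_mul_of_one_le_right hs0.le (by nlinarith)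
    have e2 : t ≤ t * (k - j) ^ 2 := le_mul_of_one_le_right ht0.le (by nlinarith)
    linarith
  have hcomb : redPt j = s • greenPt i + (1 - s - t) • greenPt j + t • greenPt k := by
    ext
    · simp only [redPt, greenPt, Prod.fst_add, Prod.smul_fst, smul_eq_mul]
      linarith
    · simp only [redPt, greenPt, Prod.snd_add, Prod.smul_snd, smul_eq_mul]
      linear_combination (-1 : ℝ) * hsum + 2 * (j : ℝ) * hst
  have hsub := subset_convexHull ℝ ({greenPt i, greenPt j, greenPt k} : Set (ℝ × ℝ))
  have hmem := (convex_convexHull ℝ ({greenPt i, greenPt j, greenPt k} : Set (ℝ × ℝ))).sum_mem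
    (t := Finset.univ) (w := ![s, 1 - s - t, t]) (z := ![greenPt i, greenPt j, greenPt k])
    (by
      intro l _
      fin_cases l
      exacts [hs0.le, (by linarith : (0 : ℝ) ≤ 1 - s - t), ht0.le])
    (by
      simp only [Fin.sum_univ_three, Matrix.cons_val]
      ring)
    (by
      intro l _
      fin_cases l <;> exact hsub (by simp))
  rw [hcomb]
  simpa [Fin.sum_univ_three] using hmem

theorem exists_greenPt_of_mem_exPts {S : Finset ℕ} {a : ℝ × ℝ}
    (ha : a ∈ exPts (parabolaCake S)) : ∃ v ∈ S, a = greenPt v := by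
  obtain ⟨hmem, hhull⟩ := Finset.mem_filter.1 ha
  rcases mem_parabolaCake.1 hmem with ⟨v, hv, rfl⟩ | ⟨j, hj, rfl⟩
  · exact ⟨v, hv, rfl⟩
  · obtain ⟨hjS, ⟨i, hi, hij⟩, k, hk, hjk⟩ := mem_innerIdx.1 hj
    refine absurd (convexHull_mono ?_ (redPt_mem_convexHull hij hjk)) hhull
    have aux : ∀ l ∈ S, greenPt l ∈ (parabolaCake S).erase (redPt j) := fun l hl =>
      Finset.mem_erase.2 ⟨greenPt_ne_redPt l j, mem_parabolaCake.2 (Or.inl ⟨l, hl, rfl⟩)⟩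
    rintro p (rfl | rfl | rfl)
    exacts [aux _ hi, aux _ hjS, aux _ hk]

theorem exPts_parabolaCake_nonempty {S : Finset ℕ} (hS : S.Nonempty) :
    (exPts (parabolaCake S)).Nonempty := by
  have hmin := S.min'_mem hS
  refine ⟨greenPt (S.min' hS), mem_exPts_of_forall_lt
    (mem_parabolaCake.2 (Or.inl ⟨_, hmin, rfl⟩)) 1 0 ?_⟩
  intro p hp hne
  have key : ∀ i : ℕ, S.min' hS < i → ((S.min' hS : ℕ) : ℝ) < i := fun i h => by exact_mod_cast h
  rcases mem_parabolaCake.1 hp with ⟨i, hi, rfl⟩ | ⟨i, hi, rfl⟩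
  · have : S.min' hS ≠ i := fun h => hne (by rw [h])
    simpa [greenPt] using key i (lt_of_le_of_ne (S.min'_le i hi) this)
  · obtain ⟨-, ⟨l, hl, hli⟩, -⟩ := mem_innerIdx.1 hi
    simpa [greenPt, redPt] using key i ((S.min'_le l hl).trans_lt hli)

theorem erase_erase_parabolaCake {S : Finset ℕ} {u v : ℕ}
    (h : innerIdx (S.erase v) = (innerIdx S).erase u) :
    ((parabolaCake S).erase (greenPt v)).erase (redPt u) = parabolaCake (S.erase v) := by
  ext p
  simp only [Finset.mem_erase, mem_parabolaCake, h]
  constructor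
  · rintro ⟨hu, hv, ⟨i, hi, rfl⟩ | ⟨i, hi, rfl⟩⟩
    · exact Or.inl ⟨i, ⟨fun e => hv (by rw [e]), hi⟩, rfl⟩
    · exact Or.inr ⟨i, ⟨fun e => hu (by rw [e]), hi⟩, rfl⟩
  · rintro (⟨i, ⟨hne, hi⟩, rfl⟩ | ⟨i, ⟨hne, hi⟩, rfl⟩)
    · exact ⟨greenPt_ne_redPt i u, fun e => hne (greenPt_injective e), Or.inl ⟨i, hi, rfl⟩⟩
    · exact ⟨fun e => hne (redPt_injective e), (greenPt_ne_redPt v i).symm, Or.inr ⟨i, hi, rfl⟩⟩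

/-- The supporting line certificate for a red point, in terms of indices only. -/
theorem redPt_mem_exPts {S : Finset ℕ} {u v : ℕ} (hu : u ∈ innerIdx S) (a b : ℝ)
    (hgreen : u = v ∨ b < 0)
    (hother : ∀ i ∈ S, i ≠ u → i ≠ v →
      a * (u : ℝ) + b * ((u : ℝ) ^ 2 + 1 / 2) < a * i + b * (i : ℝ) ^ 2 ∧
      a * (u : ℝ) + b * ((u : ℝ) ^ 2 + 1 / 2) < a * i + b * ((i : ℝ) ^ 2 + 1 / 2))
    (hv : v ∉ innerIdx S ∨ u = v) :
    redPt u ∈ exPts ((parabolaCake S).erase (greenPt v)) := by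
  refine mem_exPts_of_forall_lt (Finset.mem_erase.2 ⟨(greenPt_ne_redPt v u).symm,
    mem_parabolaCake.2 (Or.inr ⟨u, hu, rfl⟩)⟩) a b ?_
  intro p hp hne
  obtain ⟨hpv, hp⟩ := Finset.mem_erase.1 hp
  rcases mem_parabolaCake.1 hp with ⟨i, hi, rfl⟩ | ⟨i, hi, rfl⟩
  · have hiv : i ≠ v := fun e => hpv (by rw [e])
    by_cases hiu : i = u
    · subst hiu
      rcases hgreen with h | h
      · exact absurd h hiv
      · simp only [redPt, greenPt]
        linarith
    · exact (hother i hi hiu hiv).1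
  · have hiu : i ≠ u := fun e => hne (by rw [e])
    refine (hother i (mem_innerIdx.1 hi).1 hiu ?_).2
    rintro rfl
    exact hv.elim (fun h => h hi) (fun h => hiu h.symm)

/-- Bob can answer every move of Alice by taking a red point, which leads to a smaller cake of the
same kind. -/
theorem exists_redPt_reply {S : Finset ℕ} (hS : 3 ≤ S.card) {v : ℕ} (hv : v ∈ S) :
    ∃ u, redPt u ∈ exPts ((parabolaCake S).erase (greenPt v)) ∧
      innerIdx (S.erase v) = (innerIdx S).erase u := by
  have hS' : 1 < (S.erase v).card := by rw [Finset.card_erase_of_mem hv]; omega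
  have hne : (S.erase v).Nonempty := Finset.card_pos.1 (by omega)
  by_cases hlo : ∃ i ∈ S, i < v
  · by_cases hhi : ∃ k ∈ S, v < k
    · have hvi : v ∈ innerIdx S := mem_innerIdx.2 ⟨hv, hlo, hhi⟩
      refine ⟨v, redPt_mem_exPts hvi (-2 * v) 1 (Or.inl rfl) ?_ (Or.inr rfl), ?_⟩
      · intro i _ hiv _
        have h1 : (1 : ℝ) ≤ ((i : ℝ) - v) ^ 2 := by
          rcases lt_or_gt_of_ne hiv with h | h
          · have : (i : ℝ) + 1 ≤ v := by exact_mod_cast h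
            nlinarith
          · have : (v : ℝ) + 1 ≤ i := by exact_mod_cast h
            nlinarith
        constructor <;> nlinarith
      · obtain ⟨i, hi, hiv⟩ := hlo
        obtain ⟨k, hk, hvk⟩ := hhi
        ext j
        simp only [mem_innerIdx, Finset.mem_erase]
        constructor
        · rintro ⟨⟨hjv, hj⟩, ⟨i', ⟨-, hi'⟩, h1⟩, k', ⟨-, hk'⟩, h2⟩
          exact ⟨hjv, hj, ⟨i', hi', h1⟩, k', hk', h2⟩
        · rintro ⟨hjv, hj, ⟨i', hi', h1⟩, k', hk', h2⟩
          refine ⟨⟨hjv, hj⟩, ?_, ?_⟩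
          · by_cases e : i' = v
            · exact ⟨i, ⟨hiv.ne, hi⟩, by omega⟩
            · exact ⟨i', ⟨e, hi'⟩, h1⟩
          · by_cases e : k' = v
            · exact ⟨k, ⟨hvk.ne', hk⟩, by omega⟩
            · exact ⟨k', ⟨e, hk'⟩, h2⟩
    · push Not at hhi
      obtain ⟨u, hu, hmax⟩ : ∃ u ∈ S.erase v, ∀ i ∈ S.erase v, i ≤ u :=
        ⟨_, (S.erase v).max'_mem hne, fun i hi => (S.erase v).le_max' i hi⟩
      obtain ⟨l, hl, hlu⟩ := Finset.exists_mem_ne hS' u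
      have hl' := hmax l hl
      simp only [Finset.mem_erase] at hu hl hmax
      have huv := hhi u hu.2
      have hui : u ∈ innerIdx S := mem_innerIdx.2 ⟨hu.2, ⟨l, hl.2, by omega⟩, v, hv, by omega⟩
      refine ⟨u, redPt_mem_exPts hui (-1) (-1) (Or.inr (by norm_num)) ?_ (Or.inl ?_), ?_⟩
      · intro i hi hiu hiv
        have h := hmax i ⟨hiv, hi⟩
        have h1 : (i : ℝ) + 1 ≤ u := by exact_mod_cast lt_of_le_of_ne h hiu
        have h0 : (0 : ℝ) ≤ i := Nat.cast_nonneg i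
        constructor <;> nlinarith
      · rintro h
        obtain ⟨-, -, k, hk, hvk⟩ := mem_innerIdx.1 h
        exact absurd (hhi k hk) (by omega)
      · ext j
        simp only [mem_innerIdx, Finset.mem_erase]
        constructor
        · rintro ⟨⟨hjv, hj⟩, ⟨i', ⟨-, hi'⟩, h1⟩, k', hk', h2⟩
          have := hmax k' hk'
          exact ⟨by omega, hj, ⟨i', hi', h1⟩, k', hk'.2, h2⟩
        · rintro ⟨hju, hj, ⟨i', hi', h1⟩, k', hk', h2⟩
          have hjv : j ≠ v := by have := hhi k' hk'; omega
          have := hmax j ⟨hjv, hj⟩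
          have := hhi j hj
          exact ⟨⟨hjv, hj⟩, ⟨i', ⟨by omega, hi'⟩, h1⟩, u, hu, by omega⟩
  · push Not at hlo
    obtain ⟨u, hu, hmin⟩ : ∃ u ∈ S.erase v, ∀ i ∈ S.erase v, u ≤ i :=
      ⟨_, (S.erase v).min'_mem hne, fun i hi => (S.erase v).min'_le i hi⟩
    obtain ⟨l, hl, hlu⟩ := Finset.exists_mem_ne hS' u
    have hl' := hmin l hl
    simp only [Finset.mem_erase] at hu hl hmin
    have huv := hlo u hu.2
    have hui : u ∈ innerIdx S := mem_innerIdx.2 ⟨hu.2, ⟨v, hv, by omega⟩, l, hl.2, by omega⟩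
    refine ⟨u, redPt_mem_exPts hui (2 * (S.sup id : ℕ)) (-1) (Or.inr (by norm_num)) ?_
      (Or.inl ?_), ?_⟩
    · intro i hi hiu hiv
      have h := hmin i ⟨hiv, hi⟩
      have h1 : (u : ℝ) + 1 ≤ i := by exact_mod_cast lt_of_le_of_ne h (Ne.symm hiu)
      have h2 : (i : ℝ) ≤ (S.sup id : ℕ) := by exact_mod_cast Finset.le_sup (f := id) hi
      constructor <;> nlinarith
    · rintro h
      obtain ⟨-, ⟨i, hi, hiv⟩, -⟩ := mem_innerIdx.1 h
      exact absurd (hlo i hi) (by omega)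
    · ext j
      simp only [mem_innerIdx, Finset.mem_erase]
      constructor
      · rintro ⟨⟨hjv, hj⟩, ⟨i', hi', h1⟩, k', ⟨-, hk'⟩, h2⟩
        have := hmin i' hi'
        exact ⟨by omega, hj, ⟨i', hi'.2, h1⟩, k', hk', h2⟩
      · rintro ⟨hju, hj, ⟨i', hi', h1⟩, k', hk', h2⟩
        have hjv : j ≠ v := by have := hlo i' hi'; omega
        have := hmin j ⟨hjv, hj⟩
        have := hlo j hj
        exact ⟨⟨hjv, hj⟩, ⟨u, hu, by omega⟩, k', ⟨by omega, hk'⟩, h2⟩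

theorem le_gameM_parabolaCake (m : ℕ) :
    ∀ S : Finset ℕ, S.card = m + 2 → m ≤ gameM redWeight (parabolaCake S) := by
  induction m with
  | zero => exact fun _ _ => Nat.zero_le _
  | succ m ih =>
    intro S hS
    have hcard : ¬ (parabolaCake S).card ≤ 1 := by
      rw [card_parabolaCake]
      omega
    have hne : (exPts (parabolaCake S)).Nonempty :=
      exPts_parabolaCake_nonempty (Finset.card_pos.1 (by omega))
    rw [gameM, dif_neg hcard]
    refine le_csInf ?_ ?_
    · rw [Finset.coe_nonempty, Finset.image_nonempty, Finset.attach_nonempty_iff]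
      exact hne
    · intro x hx
      obtain ⟨⟨a, ha⟩, -, rfl⟩ := Finset.mem_image.1 (Finset.mem_coe.1 hx)
      obtain ⟨v, hv, rfl⟩ := exists_greenPt_of_mem_exPts ha
      obtain ⟨u, hu, hinner⟩ := exists_redPt_reply (by omega) hv
      refine le_trans ?_ (Finset.le_sup (Finset.mem_attach _ ⟨redPt u, hu⟩))
      rw [erase_erase_parabolaCake hinner, redWeight_redPt, add_comm]
      exact Nat.add_le_add_left
        (ih (S.erase v) (by rw [Finset.card_erase_of_mem hv]; omega)) 1

theorem gameM_le_sum (w : ℝ × ℝ → ℕ) (C : Finset (ℝ × ℝ)) : gameM w C ≤ ∑ c ∈ C, w c := by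
  induction C using Finset.strongInduction with
  | H C ih =>
    rw [gameM]
    split_ifs with h
    · exact Nat.zero_le _
    · rcases (exPts C).eq_empty_or_nonempty with he | ⟨a, ha⟩
      · have hempty : (exPts C).attach = ∅ := Finset.attach_eq_empty_iff.2 he
        rw [hempty, Finset.image_empty, Finset.coe_empty, Nat.sInf_empty]
        exact Nat.zero_le _
      · have haC : a ∈ C := Finset.mem_of_mem_filter _ ha
        refine (Nat.sInf_le (Finset.mem_coe.2 (Finset.mem_image_of_mem _
          (Finset.mem_attach _ ⟨a, ha⟩)))).trans (Finset.sup_le ?_)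
        rintro ⟨b, hb⟩ -
        have hbC : b ∈ C.erase a := Finset.mem_of_mem_filter _ hb
        have hlt : (C.erase a).erase b ⊂ C :=
          (Finset.erase_ssubset hbC).trans (Finset.erase_ssubset haC)
        have h1 := Finset.add_sum_erase (C.erase a) w hbC
        have h2 := Finset.add_sum_erase C w haC
        have h3 := ih _ hlt
        dsimp only
        omega

theorem sum_redWeight_parabolaCake (S : Finset ℕ) :
    ∑ p ∈ parabolaCake S, redWeight p = (innerIdx S).card := by
  rw [← Finset.card_image_of_injective _ redPt_injective, ← filter_redWeight_parabolaCake,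
    Finset.card_filter]
  refine Finset.sum_congr rfl fun p _ => ?_
  have := redWeight_le_one p
  split_ifs <;> omega

theorem orientDet_pos_of_lt {x y z d e f : ℝ} (hxy : x + 1 ≤ y) (hyz : y + 1 ≤ z)
    (hd : 0 ≤ d) (he : e ≤ 1 / 2) (hf : 0 ≤ f) :
    0 < orientDet (x, x ^ 2 + d) (y, y ^ 2 + e) (z, z ^ 2 + f) := by
  obtain ⟨a, rfl⟩ : ∃ a, y = x + 1 + a := ⟨y - x - 1, by ring⟩
  obtain ⟨b, rfl⟩ : ∃ b, z = x + 1 + a + 1 + b := ⟨z - (x + 1 + a) - 1, by ring⟩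
  have ha : 0 ≤ a := by linarith
  have hb : 0 ≤ b := by linarith
  have h1 := mul_nonneg ha hb
  have h2 : 0 ≤ (1 + a) * f := by positivity
  have h3 : 0 ≤ (1 + b) * d := by positivity
  have h4 : 0 ≤ (2 + a + b) * (1 / 2 - e) := mul_nonneg (by linarith) (by linarith)
  have h5 : 0 ≤ (2 + a + b) * (a + b + a * b) := by positivity
  simp only [orientDet]
  nlinarith

theorem orientDet_swap_left (p q r : ℝ × ℝ) : orientDet q p r = -orientDet p q r := by
  simp only [orientDet]
  ring

theorem orientDet_swap_right (p q r : ℝ × ℝ) : orientDet p r q = -orientDet p q r := by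
  simp only [orientDet]
  ring

theorem genPos_parabolaCake (S : Finset ℕ) : GenPos (↑(parabolaCake S) : Set (ℝ × ℝ)) := by
  have rep : ∀ p ∈ parabolaCake S, ∃ (i : ℕ) (d : ℝ), p = ((i : ℝ), (i : ℝ) ^ 2 + d) ∧
      (d = 0 ∨ d = 1 / 2) := by
    intro p hp
    obtain ⟨i, -, rfl | rfl⟩ := exists_index_of_mem hp
    · exact ⟨i, 0, by simp [greenPt], Or.inl rfl⟩
    · exact ⟨i, 1 / 2, rfl, Or.inr rfl⟩
  have pos : ∀ {i j k : ℕ} {d e f : ℝ}, i < j → j < k → (d = 0 ∨ d = 1 / 2) →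
      (e = 0 ∨ e = 1 / 2) → (f = 0 ∨ f = 1 / 2) →
      0 < orientDet ((i : ℝ), (i : ℝ) ^ 2 + d) ((j : ℝ), (j : ℝ) ^ 2 + e)
        ((k : ℝ), (k : ℝ) ^ 2 + f) := by
    intro i j k d e f hij hjk hd he hf
    refine orientDet_pos_of_lt (by exact_mod_cast hij) (by exact_mod_cast hjk) ?_ ?_ ?_
    · rcases hd with rfl | rfl <;> norm_num
    · rcases he with rfl | rfl <;> norm_num
    · rcases hf with rfl | rfl <;> norm_num
  have col : ∀ {i k : ℕ} {d e f : ℝ}, (d = 0 ∨ d = 1 / 2) → (e = 0 ∨ e = 1 / 2) →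
      (f = 0 ∨ f = 1 / 2) → d ≠ e → (i = k → d ≠ f ∧ e ≠ f) →
      orientDet ((i : ℝ), (i : ℝ) ^ 2 + d) ((i : ℝ), (i : ℝ) ^ 2 + e)
        ((k : ℝ), (k : ℝ) ^ 2 + f) ≠ 0 := by
    intro i k d e f hd he hf hde hik h0
    have hne : i ≠ k := by
      intro h
      obtain ⟨h1, h2⟩ := hik h
      rcases hd with rfl | rfl <;> rcases he with rfl | rfl <;> rcases hf with rfl | rfl <;>
        simp_all
    have h : (d - e) * ((k : ℝ) - i) = 0 := by
      rw [← h0]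
      simp only [orientDet]
      ring
    rcases mul_eq_zero.1 h with h | h
    · exact hde (sub_eq_zero.1 h)
    · exact hne (by exact_mod_cast (sub_eq_zero.1 h).symm)
  intro p hp q hq r hr hpq hpr hqr
  obtain ⟨i, d, rfl, hd⟩ := rep p (Finset.mem_coe.1 hp)
  obtain ⟨j, e, rfl, he⟩ := rep q (Finset.mem_coe.1 hq)
  obtain ⟨k, f, rfl, hf⟩ := rep r (Finset.mem_coe.1 hr)
  have hpq' : i = j → d ≠ e := by rintro rfl rfl; exact hpq rfl
  have hpr' : i = k → d ≠ f := by rintro rfl rfl; exact hpr rfl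
  have hqr' : j = k → e ≠ f := by rintro rfl rfl; exact hqr rfl
  by_cases hij : i = j
  · subst hij
    exact col hd he hf (hpq' rfl) fun h => ⟨hpr' h, hqr' h⟩
  by_cases hik : i = k
  · subst hik
    rw [orientDet_swap_right, neg_ne_zero]
    exact col hd hf he (hpr' rfl) fun h => absurd h hij
  by_cases hjk : j = k
  · subst hjk
    rw [orientDet_swap_left, orientDet_swap_right, neg_neg]
    exact col he hf hd (hqr' rfl) fun h => absurd h.symm hij
  rcases lt_or_gt_of_ne hij with h1 | h1 <;> rcases lt_or_gt_of_ne hik with h2 | h2 <;>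
    rcases lt_or_gt_of_ne hjk with h3 | h3
  · exact (pos h1 h3 hd he hf).ne'
  · rw [orientDet_swap_right, neg_ne_zero]
    exact (pos h2 h3 hd hf he).ne'
  · omega
  · rw [orientDet_swap_right, orientDet_swap_left, neg_neg]
    exact (pos h2 h1 hf hd he).ne'
  · rw [orientDet_swap_left, neg_ne_zero]
    exact (pos h1 h2 he hd hf).ne'
  · omega
  · rw [orientDet_swap_left, orientDet_swap_right, neg_neg]
    exact (pos h3 h2 he hf hd).ne'
  · rw [orientDet_swap_left, orientDet_swap_right, orientDet_swap_left, neg_neg, neg_ne_zero]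
    exact (pos h3 h1 hf he hd).ne'

/-- For every `m ∈ ℕ` there exists an even-sized cake `𝒞` with `R(𝒞) = m`
and `M(𝒞) = m`: with optimal play Bob obtains the entirety of the total weight. -/
theorem statement8 (m : ℕ) :
    ∃ (C : Finset (ℝ × ℝ)) (w : ℝ × ℝ → ℕ),
      (∀ p, w p ≤ 1) ∧ GenPos (↑C : Set (ℝ × ℝ)) ∧ Even C.card ∧
      (C.filter (fun p => w p = 1)).card = m ∧
      gameM w C = m := by
  have hinner := card_innerIdx_range m
  refine ⟨parabolaCake (Finset.range (m + 2)), redWeight, redWeight_le_one,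
    genPos_parabolaCake _, ?_, ?_, le_antisymm ?_ ?_⟩
  · rw [card_parabolaCake, hinner, Finset.card_range]
    exact ⟨m + 1, by ring⟩
  · rw [filter_redWeight_parabolaCake, Finset.card_image_of_injective _ redPt_injective, hinner]
  · exact (gameM_le_sum _ _).trans_eq ((sum_redWeight_parabolaCake _).trans hinner)
  · exact le_gameM_parabolaCake m _ (Finset.card_range _)

end
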